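/- Let n > 0, let M satisfy M''(μ) − M'(μ)/μ − n²M(μ) = 0 on (0,∞) and N satisfy N''(ν) − N'(ν)/ν + n²N(ν) = 0 on (0,∞). Then ψ(μ,ν) = (μ²+ν²)⁻¹ M(μ)N(ν) satisfies the cardioid Stokes equation ∂²ψ/∂μ² + (3μ²−ν²)/(μ(μ²+ν²)) ∂ψ/∂μ + (3ν²−μ²)/(ν(μ²+ν²)) ∂ψ/∂ν + ∂²ψ/∂ν² = 0 for all μ, ν > 0. -/

import Mathlib

theorem deriv_inv_sq_add_sq_mul {f : ℝ → ℝ} {x : ℝ} (c K : ℝ) (hx : 0 < x)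
    (hf : DifferentiableAt ℝ f x) :
    deriv (fun m => (m ^ 2 + c ^ 2)⁻¹ * f m * K) x =
      (deriv f x / (x ^ 2 + c ^ 2) - 2 * x * f x / (x ^ 2 + c ^ 2) ^ 2) * K := by
  have hR : x ^ 2 + c ^ 2 ≠ 0 := by positivity
  have h := ((((hasDerivAt_pow 2 x).add_const (c ^ 2)).fun_inv hR).fun_mul hf.hasDerivAt).mul_const K
  rw [h.deriv]
  field_simp
  push_cast
  ring

theorem deriv_deriv_inv_sq_add_sq_mul {f : ℝ → ℝ} {x : ℝ} (c K : ℝ) (hx : 0 < x)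
    (hf : ∀ y > 0, DifferentiableAt ℝ f y) (hf' : DifferentiableAt ℝ (deriv f) x) :
    deriv (deriv (fun m => (m ^ 2 + c ^ 2)⁻¹ * f m * K)) x =
      (deriv (deriv f) x / (x ^ 2 + c ^ 2) - 4 * x * deriv f x / (x ^ 2 + c ^ 2) ^ 2
        - 2 * f x / (x ^ 2 + c ^ 2) ^ 2 + 8 * x ^ 2 * f x / (x ^ 2 + c ^ 2) ^ 3) * K := by
  have hR : x ^ 2 + c ^ 2 ≠ 0 := by positivity
  have heq : deriv (fun m => (m ^ 2 + c ^ 2)⁻¹ * f m * K) =ᶠ[nhds x] fun y =>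
      (deriv f y / (y ^ 2 + c ^ 2) - 2 * y * f y / (y ^ 2 + c ^ 2) ^ 2) * K := by
    filter_upwards [lt_mem_nhds hx] with y hy
    exact deriv_inv_sq_add_sq_mul c K hy (hf y hy)
  rw [heq.deriv_eq]
  have hd := (hasDerivAt_pow 2 x).add_const (c ^ 2)
  have h := ((hf'.hasDerivAt.fun_div hd hR).fun_sub
    ((((hasDerivAt_id' x).const_mul 2).fun_mul (hf x hx).hasDerivAt).fun_div
      (hd.fun_pow 2) (pow_ne_zero 2 hR))).mul_const K
  rw [h.deriv]
  field_simp
  push_cast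
  ring


theorem cardioid_stokes_solution (n : ℝ) (hn : 0 < n) (M N : ℝ → ℝ)
    (hM1 : ∀ x > 0, DifferentiableAt ℝ M x)
    (hM2 : ∀ x > 0, DifferentiableAt ℝ (deriv M) x)
    (hN1 : ∀ x > 0, DifferentiableAt ℝ N x)
    (hN2 : ∀ x > 0, DifferentiableAt ℝ (deriv N) x)
    (hM : ∀ μ > 0, deriv (deriv M) μ - deriv M μ / μ - n ^ 2 * M μ = 0)
    (hN : ∀ ν > 0, deriv (deriv N) ν - deriv N ν / ν + n ^ 2 * N ν = 0) :
    ∀ μ > 0, ∀ ν > 0,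
      deriv (deriv (fun m => (m ^ 2 + ν ^ 2)⁻¹ * M m * N ν)) μ
        + (3 * μ ^ 2 - ν ^ 2) / (μ * (μ ^ 2 + ν ^ 2)) *
            deriv (fun m => (m ^ 2 + ν ^ 2)⁻¹ * M m * N ν) μ
        + (3 * ν ^ 2 - μ ^ 2) / (ν * (μ ^ 2 + ν ^ 2)) *
            deriv (fun nn => (μ ^ 2 + nn ^ 2)⁻¹ * M μ * N nn) ν
        + deriv (deriv (fun nn => (μ ^ 2 + nn ^ 2)⁻¹ * M μ * N nn)) ν = 0 := by
  intro μ hμ ν hν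
  have hswap : (fun nn => (μ ^ 2 + nn ^ 2)⁻¹ * M μ * N nn) =
      fun nn => (nn ^ 2 + μ ^ 2)⁻¹ * N nn * M μ := by
    funext y
    rw [add_comm (μ ^ 2)]
    ring
  rw [hswap, deriv_deriv_inv_sq_add_sq_mul ν (N ν) hμ hM1 (hM2 μ hμ),
    deriv_inv_sq_add_sq_mul ν (N ν) hμ (hM1 μ hμ),
    deriv_deriv_inv_sq_add_sq_mul μ (M μ) hν hN1 (hN2 ν hν),
    deriv_inv_sq_add_sq_mul μ (M μ) hν (hN1 ν hν), add_comm (ν ^ 2) (μ ^ 2)]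
  have hM' : deriv (deriv M) μ = deriv M μ / μ + n ^ 2 * M μ := by linarith [hM μ hμ]
  have hN' : deriv (deriv N) ν = deriv N ν / ν - n ^ 2 * N ν := by linarith [hN ν hν]
  rw [hM', hN']
  field_simp
  ring
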